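/- arXiv:2007.14674 — 8 statements merged into one kernel-verified Lean document; each statement's English description precedes it below -/
import Mathlib

section
/- Let H be a complex Hilbert space, and let B and C be linear operators in H such that B² (with domain D(B²)) is m-accretive, C is accretive and closed, and D(B²) ⊆ D(C). Assume condition (C.1): there exist constants α ≥ 0, 0 ≤ β < 1 and δ ≥ 0 such that Re⟨B²x, Cx⟩ ≥ −α‖x‖² − β‖B²x‖² − δ‖B²x‖·‖x‖ for all x ∈ D(B²). Then the operator Λ = B² + C with domain D(B²) is m-accretive. -/
/-- A linear operator `T` (given as a total linear map, restricted to the domain `D`)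
is accretive on `D` : `Re ⟨Tx, x⟩ ≥ 0` for all `x ∈ D`. -/
def IsAccretiveOn {H : Type*} [NormedAddCommGroup H] [InnerProductSpace ℂ H]
    (T : H →ₗ[ℂ] H) (D : Submodule ℂ H) : Prop :=
  ∀ x ∈ D, 0 ≤ (inner ℂ (T x) x : ℂ).re

/-- `T` with domain `D` is m-accretive: accretive, densely defined, and `T + λ` is
surjective (from `D`) for some `λ > 0`. -/
def IsMAccretiveOn {H : Type*} [NormedAddCommGroup H] [InnerProductSpace ℂ H]
    (T : H →ₗ[ℂ] H) (D : Submodule ℂ H) : Prop :=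
  IsAccretiveOn T D ∧ Dense (D : Set H) ∧
    ∃ lam : ℝ, 0 < lam ∧ ∀ y : H, ∃ x ∈ D, T x + (lam : ℂ) • x = y

/-- `T` with domain `D` is closed: its graph is a closed subset of `H × H`. -/
def IsClosedOn {H : Type*} [NormedAddCommGroup H] [InnerProductSpace ℂ H]
    (T : H →ₗ[ℂ] H) (D : Submodule ℂ H) : Prop :=
  IsClosed {p : H × H | p.1 ∈ D ∧ T p.1 = p.2}

open Filter Topology in
/-- method of continuity for perturbations `1 + t K`. -/
theorem moc_aux {H : Type*} [NormedAddCommGroup H] [NormedSpace ℂ H] [CompleteSpace H]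
    (K : H →L[ℂ] H) (c : ℝ) (hc : 0 < c)
    (hb : ∀ t : ℝ, 0 ≤ t → t ≤ 1 → ∀ y : H, ‖y‖ ≤ c * ‖y + (t : ℂ) • K y‖) :
    ∀ y : H, ∃ z : H, z + K z = y := by
  obtain ⟨N, hN⟩ := exists_nat_gt (c * ‖K‖)
  have hNpos : (0 : ℝ) < N := lt_of_le_of_lt (by positivity) hN
  have key : ∀ n : ℕ, n ≤ N → IsUnit (1 + (((n : ℝ) / N : ℝ) : ℂ) • K) := by
    intro n
    induction n with
    | zero => intro _; simp
    | succ n ih =>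
      intro hn
      obtain ⟨U, hU⟩ := ih (by omega)
      have hnN : (n : ℝ) ≤ N := by exact_mod_cast (by omega : n ≤ N)
      have hinv : ‖(↑U⁻¹ : H →L[ℂ] H)‖ ≤ c := by
        refine ContinuousLinearMap.opNorm_le_bound _ hc.le fun y => ?_
        have h1 := hb ((n : ℝ) / N) (by positivity) (by rw [div_le_one hNpos]; exact hnN)
          ((↑U⁻¹ : H →L[ℂ] H) y)
        have h2 : (U : H →L[ℂ] H) ((↑U⁻¹ : H →L[ℂ] H) y) = y := by
          have := congrArg (fun f : H →L[ℂ] H => f y) U.mul_inv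
          exact this
        rw [hU] at h2
        have h3 : (↑U⁻¹ : H →L[ℂ] H) y + (((n : ℝ) / N : ℝ) : ℂ) • K ((↑U⁻¹ : H →L[ℂ] H) y) = y := by
          simpa using h2
        rwa [h3] at h1
      have hsm : ‖-(((1 / N : ℝ) : ℂ) • ((↑U⁻¹ : H →L[ℂ] H) * K))‖ < 1 := by
        rw [norm_neg, norm_smul, Complex.norm_real, Real.norm_of_nonneg (by positivity)]
        have h4 : ‖(↑U⁻¹ : H →L[ℂ] H) * K‖ ≤ c * ‖K‖ :=
          (norm_mul_le _ _).trans (by gcongr)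
        rw [one_div, inv_mul_lt_iff₀ hNpos]
        linarith
      have h5 : (1 + ((((n + 1 : ℕ) : ℝ) / N : ℝ) : ℂ) • K)
          = (U : H →L[ℂ] H) * (Units.oneSub _ hsm : (H →L[ℂ] H)ˣ) := by
        rw [Units.val_oneSub, sub_neg_eq_add, mul_add, mul_one, mul_smul_comm, ← mul_assoc,
          U.mul_inv, one_mul, hU, add_assoc, ← add_smul]
        congr 2
        push_cast
        ring
      rw [h5]
      exact U.isUnit.mul (Units.isUnit _)
  obtain ⟨U, hU⟩ := key N le_rfl
  intro y
  refine ⟨(↑U⁻¹ : H →L[ℂ] H) y, ?_⟩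
  have h2 : (U : H →L[ℂ] H) ((↑U⁻¹ : H →L[ℂ] H) y) = y := by
    have := congrArg (fun f : H →L[ℂ] H => f y) U.mul_inv
    exact this
  rw [hU, div_self hNpos.ne'] at h2
  simpa using h2

theorem real_aux (a x m l α β δ t : ℝ) (ha : 0 ≤ a) (hx : 0 ≤ x) (hm : 0 ≤ m) (hl : 0 < l)
    (hα : 0 ≤ α) (hβ0 : 0 ≤ β) (hβ1 : β < 1) (hδ : 0 ≤ δ) (ht0 : 0 ≤ t) (ht1 : t ≤ 1)
    (h1 : l * x ≤ m)
    (h2 : a ^ 2 + t * (-α * x ^ 2 - β * a ^ 2 - δ * a * x) ≤ a * m) :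
    a + l * x ≤ ((2 + δ / l + α / l ^ 2) / (1 - β) + 1) * m := by
  have hb : 0 < 1 - β := by linarith
  have hx' : x ≤ m / l := by rw [le_div_iff₀ hl]; linarith
  have hx2 : x ^ 2 ≤ (m / l) ^ 2 := by gcongr
  have hS : 0 ≤ α * x ^ 2 + β * a ^ 2 + δ * a * x := by positivity
  have h3 : (1 - β) * a ^ 2 ≤ a * m + α * x ^ 2 + δ * a * x := by nlinarith
  have h4 : α * x ^ 2 ≤ α / l ^ 2 * m ^ 2 := by
    calc α * x ^ 2 ≤ α * (m / l) ^ 2 := by gcongr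
      _ = _ := by ring
  have h5 : δ * a * x ≤ δ / l * (a * m) := by
    calc δ * a * x ≤ δ * a * (m / l) := by gcongr
      _ = _ := by ring
  have p1 : 0 ≤ δ / l := by positivity
  have p2 : 0 ≤ α / l ^ 2 := by positivity
  generalize δ / l = d at *
  generalize α / l ^ 2 = e at *
  have h6 : a ≤ (2 + d + e) / (1 - β) * m := by
    rw [div_mul_eq_mul_div, le_div_iff₀ hb]
    rcases le_total a m with h | h
    · nlinarith [mul_nonneg p1 hm, mul_nonneg p2 hm, mul_nonneg ha hβ0]
    · rcases ha.eq_or_lt with h0 | h0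
      · rw [← h0, zero_mul]; positivity
      · have h7 : e * m ^ 2 ≤ e * (a * m) := by
          apply mul_le_mul_of_nonneg_left _ p2; nlinarith
        have h8 : a * (a * (1 - β)) ≤ a * ((2 + d + e) * m) := by nlinarith [mul_nonneg ha hm]
        exact le_of_mul_le_mul_left h8 h0
  linarith

open Filter Topology in
theorem main_aux {H : Type*} [NormedAddCommGroup H] [InnerProductSpace ℂ H] [CompleteSpace H]
    (A C : H →ₗ[ℂ] H) (D DC : Submodule ℂ H)
    (hA : IsMAccretiveOn A D)
    (hC : IsAccretiveOn C DC) (hCclosed : IsClosedOn C DC)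
    (hdom : D ≤ DC)
    (α β δ : ℝ) (hα : 0 ≤ α) (hβ0 : 0 ≤ β) (hβ1 : β < 1) (hδ : 0 ≤ δ)
    (hC1 : ∀ x ∈ D,
      -α * ‖x‖ ^ 2 - β * ‖A x‖ ^ 2 - δ * ‖A x‖ * ‖x‖ ≤ (inner ℂ (A x) (C x) : ℂ).re) :
    IsMAccretiveOn (A + C) D := by
  obtain ⟨hacc, hdense, l, hl, hsurj⟩ := hA
  refine ⟨?_, hdense, l, hl, ?_⟩
  · intro x hx
    rw [LinearMap.add_apply, inner_add_left, Complex.add_re]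
    exact add_nonneg (hacc x hx) (hC x (hdom hx))
  have hlow : ∀ t : ℝ, 0 ≤ t → ∀ x ∈ D,
      l * ‖x‖ ≤ ‖A x + (l : ℂ) • x + (t : ℂ) • C x‖ := by
    intro t ht x hx
    have h1 : l * ‖x‖ ^ 2 ≤ (inner ℂ (A x + (l : ℂ) • x + (t : ℂ) • C x) x : ℂ).re := by
      have e1 := hacc x hx
      have e2 := mul_nonneg ht (hC x (hdom hx))
      have e3 : (inner ℂ x x : ℂ).re = ‖x‖ ^ 2 := by
        rw [inner_self_eq_norm_sq_to_K]; norm_cast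
      simp only [inner_add_left, inner_smul_left, Complex.conj_ofReal, Complex.add_re,
        Complex.re_ofReal_mul, e3]
      linarith
    have h2 : (inner ℂ (A x + (l : ℂ) • x + (t : ℂ) • C x) x : ℂ).re ≤
        ‖A x + (l : ℂ) • x + (t : ℂ) • C x‖ * ‖x‖ :=
      (Complex.re_le_norm _).trans (norm_inner_le_norm _ _)
    rcases (norm_nonneg x).eq_or_lt with h0 | h0
    · rw [← h0, mul_zero]; positivity
    · refine le_of_mul_le_mul_right ?_ h0
      nlinarith
  have hlow0 : ∀ x ∈ D, l * ‖x‖ ≤ ‖A x + (l : ℂ) • x‖ := by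
    intro x hx
    simpa using hlow 0 le_rfl x hx
  choose g hgD hg using hsurj
  have huniq : ∀ x ∈ D, ∀ x' ∈ D, A x + (l : ℂ) • x = A x' + (l : ℂ) • x' → x = x' := by
    intro x hx x' hx' h
    have h1 := hlow0 (x - x') (D.sub_mem hx hx')
    have h2 : A (x - x') + (l : ℂ) • (x - x') = 0 := by
      rw [map_sub, smul_sub, ← sub_eq_zero.mpr h]; abel
    rw [h2, norm_zero] at h1
    have h3 : ‖x - x'‖ ≤ 0 := by
      by_contra h4
      push Not at h4
      nlinarith [mul_pos hl h4]
    exact sub_eq_zero.mp (norm_le_zero_iff.mp h3)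
  let R : H →ₗ[ℂ] H :=
    { toFun := g
      map_add' := by
        intro y z
        apply huniq _ (hgD _) _ (D.add_mem (hgD _) (hgD _))
        rw [hg, map_add, smul_add]
        calc y + z = (A (g y) + (l : ℂ) • g y) + (A (g z) + (l : ℂ) • g z) := by rw [hg, hg]
          _ = _ := by abel
      map_smul' := by
        intro k y
        apply huniq _ (hgD _) _ (D.smul_mem _ (hgD _))
        rw [hg, RingHom.id_apply, map_smul, smul_comm, ← smul_add, hg] }
  have hRD : ∀ y, R y ∈ D := hgD
  have hR : ∀ y, A (R y) + (l : ℂ) • R y = y := hg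
  have hRb : ∀ y, ‖R y‖ ≤ l⁻¹ * ‖y‖ := by
    intro y
    have := hlow0 (R y) (hRD y)
    rw [hR] at this
    rw [inv_mul_eq_div, le_div_iff₀ hl]
    linarith
  have hRc : Continuous R := (LinearMap.mkContinuous R l⁻¹ hRb).continuous
  have hKc : Continuous (C ∘ₗ R) := by
    apply LinearMap.continuous_of_seq_closed_graph
    intro u x y hu hy
    have h1 : Tendsto (fun n => (R (u n), C (R (u n)))) atTop (𝓝 (R x, y)) :=
      ((hRc.tendsto x).comp hu).prodMk_nhds hy
    have h2 := hCclosed.mem_of_tendsto h1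
      (Eventually.of_forall fun n => ⟨hdom (hRD (u n)), rfl⟩)
    exact h2.2.symm
  let K : H →L[ℂ] H := ⟨C ∘ₗ R, hKc⟩
  have hK : ∀ y, K y = C (R y) := fun y => rfl
  have hb : 0 < 1 - β := by linarith
  have := moc_aux K ((2 + δ / l + α / l ^ 2) / (1 - β) + 1) (by positivity) (by
    intro t ht0 ht1 y
    have hx := hRD y
    have h1 := hlow t ht0 _ hx
    rw [hR] at h1
    rw [hK]
    have e1 := hacc _ hx
    have e3 : (inner ℂ (A (R y)) (A (R y)) : ℂ).re = ‖A (R y)‖ ^ 2 := by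
      rw [inner_self_eq_norm_sq_to_K]; norm_cast
    have h2 : (inner ℂ (A (R y)) (A (R y) + (l : ℂ) • R y + (t : ℂ) • C (R y)) : ℂ).re ≤
        ‖A (R y)‖ * ‖y + (t : ℂ) • C (R y)‖ := by
      refine ((Complex.re_le_norm _).trans (norm_inner_le_norm _ _)).trans_eq ?_
      rw [hR]
    simp only [inner_add_right, inner_smul_right, Complex.add_re,
        Complex.re_ofReal_mul, e3] at h2
    have e4 := mul_le_mul_of_nonneg_left (hC1 _ hx) ht0
    have h3 := real_aux ‖A (R y)‖ ‖R y‖ ‖y + (t : ℂ) • C (R y)‖ l α β δ t (norm_nonneg _)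
      (norm_nonneg _) (norm_nonneg _) hl hα hβ0 hβ1 hδ ht0 ht1 h1
      (by linarith [mul_nonneg hl.le e1])
    refine le_trans ?_ h3
    calc ‖y‖ = ‖A (R y) + (l : ℂ) • R y‖ := by rw [hR]
      _ ≤ ‖A (R y)‖ + ‖(l : ℂ) • R y‖ := norm_add_le _ _
      _ = _ := by rw [norm_smul, Complex.norm_real, Real.norm_of_nonneg hl.le])
  intro y
  obtain ⟨z, hz⟩ := this y
  refine ⟨R z, hRD z, ?_⟩
  rw [hK] at hz
  rw [LinearMap.add_apply, ← hz]
  nth_rewrite 4 [← hR z]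
  abel

/-- if `B²` (with domain `D(B²)`) is m-accretive, `C` is accretive and
closed, `D(B²) ⊆ D(C)` and condition (C.1) holds, then `Λ = B² + C` with domain
`D(B²)` is m-accretive. -/
theorem stmt0 {H : Type*} [NormedAddCommGroup H] [InnerProductSpace ℂ H] [CompleteSpace H]
    (B C : H →ₗ[ℂ] H) (DB DC : Submodule ℂ H)
    (hB2 : IsMAccretiveOn (B.comp B) (DB ⊓ DB.comap B))
    (hC : IsAccretiveOn C DC) (hCclosed : IsClosedOn C DC)
    (hdom : DB ⊓ DB.comap B ≤ DC)
    (α β δ : ℝ) (hα : 0 ≤ α) (hβ0 : 0 ≤ β) (hβ1 : β < 1) (hδ : 0 ≤ δ)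
    (hC1 : ∀ x ∈ DB ⊓ DB.comap B,
      -α * ‖x‖ ^ 2 - β * ‖B (B x)‖ ^ 2 - δ * ‖B (B x)‖ * ‖x‖ ≤
        (inner ℂ (B (B x)) (C x) : ℂ).re) :
    IsMAccretiveOn (B.comp B + C) (DB ⊓ DB.comap B) := by
  exact main_aux (B.comp B) C (DB ⊓ DB.comap B) DC hB2 hC hCclosed hdom α β δ hα hβ0 hβ1 hδ hC1
end

section
/- Let H be a complex Hilbert space, and let B and C be closed linear operators in H such that B is accretive, B² (with domain D(B²)) is m-accretive, C is accretive, and D(B) ⊆ D(C) (condition (C.4)). Then the operator Λ = B² + C with domain D(B²) is m-accretive. -/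
theorem le_of_sq_le_sq_aux {a b : ℝ} (h : a ^ 2 ≤ b ^ 2) (hb : 0 ≤ b) : a ≤ b :=
  le_of_not_gt fun hlt => by nlinarith

/-- Perturbation: if `P` maps `D` onto `H` and `K` is `P`-small on `D`, then `P + K` is onto. -/
theorem surj_perturb {H : Type*} [NormedAddCommGroup H] [InnerProductSpace ℂ H] [CompleteSpace H]
    (P K : H →ₗ[ℂ] H) (D : Submodule ℂ H)
    (hP : ∀ y : H, ∃ x ∈ D, P x = y)
    (hK : ∀ x ∈ D, ‖K x‖ ≤ (1 / 2) * ‖P x‖) :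
    ∀ y : H, ∃ x ∈ D, P x + K x = y := by
  have hsurj : LinearMap.range (P.comp D.subtype) = ⊤ := by
    rw [LinearMap.range_eq_top]
    intro y
    obtain ⟨x, hx, rfl⟩ := hP y
    exact ⟨⟨x, hx⟩, rfl⟩
  obtain ⟨S, hS⟩ := (P.comp D.subtype).exists_rightInverse_of_surjective hsurj
  have hS' : ∀ y, P (S y : H) = y := fun y => by
    have := LinearMap.congr_fun hS y
    simpa using this
  let T : H →L[ℂ] H := LinearMap.mkContinuous (-(K.comp (D.subtype.comp S))) (1 / 2) (by
    intro y
    have := hK (S y) (S y).2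
    rw [hS'] at this
    simpa using this)
  have hT : ‖T‖ < 1 :=
    lt_of_le_of_lt (LinearMap.mkContinuous_norm_le _ (by norm_num) _) (by norm_num)
  intro y
  let U := Units.oneSub T hT
  have hU : (U : H →L[ℂ] H) ((↑U⁻¹ : H →L[ℂ] H) y) = y := by
    have := congrArg (fun f : H →L[ℂ] H => f y) U.mul_inv
    exact this
  refine ⟨S ((↑U⁻¹ : H →L[ℂ] H) y), (S _).2, ?_⟩
  rw [hS']
  generalize (↑U⁻¹ : H →L[ℂ] H) y = z at hU
  have h2 : (U : H →L[ℂ] H) z = z - T z := by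
    simp [U, Units.val_oneSub]
  rw [h2] at hU
  rw [← hU]
  simp [T]

/-- Basic resolvent estimates. -/
theorem accretive_est {H : Type*} [NormedAddCommGroup H] [InnerProductSpace ℂ H]
    (a x : H) (h : 0 ≤ (inner ℂ a x : ℂ).re) (l : ℝ) (hl : 0 < l) :
    ‖a‖ ≤ ‖a + (l : ℂ) • x‖ ∧ l * ‖x‖ ≤ ‖a + (l : ℂ) • x‖ := by
  have h1 := @norm_add_sq ℂ H _ _ _ a ((l : ℂ) • x)
  have h2 : ‖(l : ℂ) • x‖ = l * ‖x‖ := by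
    rw [norm_smul]; simp [abs_of_pos hl]
  have h3 : RCLike.re (inner ℂ a ((l : ℂ) • x)) = l * (inner ℂ a x : ℂ).re := by
    rw [inner_smul_right]; simp
  rw [h2, h3] at h1
  have h4 : 0 ≤ l * (inner ℂ a x : ℂ).re := by positivity
  constructor
  · apply le_of_sq_le_sq_aux ?_ (norm_nonneg _)
    nlinarith [sq_nonneg (l * ‖x‖)]
  · apply le_of_sq_le_sq_aux ?_ (norm_nonneg _)
    nlinarith [sq_nonneg (‖a‖)]

/-- Landau type inequality. -/
theorem landau_est {H : Type*} [NormedAddCommGroup H] [InnerProductSpace ℂ H]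
    (a b x : H) (t : ℝ) (ht : 0 < t)
    (h : 0 ≤ (inner ℂ a x : ℂ).re)
    (h' : 0 ≤ (inner ℂ (a - (t : ℂ) • b) (b - (t : ℂ) • x) : ℂ).re) :
    t * ‖b‖ ≤ ‖a‖ + t ^ 2 * ‖x‖ := by
  have e : (inner ℂ (a - (t : ℂ) • b) (b - (t : ℂ) • x) : ℂ).re =
      (inner ℂ a b : ℂ).re - t * (inner ℂ a x : ℂ).re - t * ‖b‖ ^ 2
        + t ^ 2 * (inner ℂ b x : ℂ).re := by
    have hb : (inner ℂ b b : ℂ).re = ‖b‖ ^ 2 := inner_self_eq_norm_sq (𝕜 := ℂ) b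
    rw [← hb]
    simp only [inner_sub_left, inner_sub_right, inner_smul_left, inner_smul_right,
      Complex.conj_ofReal, Complex.sub_re, Complex.re_ofReal_mul]
    ring
  rw [e] at h'
  have h1 : (inner ℂ a b : ℂ).re ≤ ‖a‖ * ‖b‖ := re_inner_le_norm (𝕜 := ℂ) a b
  have h2 : (inner ℂ b x : ℂ).re ≤ ‖b‖ * ‖x‖ := re_inner_le_norm (𝕜 := ℂ) b x
  have h3 : 0 ≤ t * (inner ℂ a x : ℂ).re := by positivity
  have h4 : t ^ 2 * (inner ℂ b x : ℂ).re ≤ t ^ 2 * (‖b‖ * ‖x‖) := by gcongr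
  rcases (norm_nonneg b).eq_or_lt with hb | hb
  · rw [← hb]; simp; positivity
  · refine le_of_mul_le_mul_right ?_ hb
    nlinarith

/-- Closed graph theorem: `C` is `B`-bounded. -/
theorem rel_bound {H : Type*} [NormedAddCommGroup H] [InnerProductSpace ℂ H] [CompleteSpace H]
    (B C : H →ₗ[ℂ] H) (DB DC : Submodule ℂ H)
    (hBclosed : IsClosedOn B DB) (hCclosed : IsClosedOn C DC) (hdom : DB ≤ DC) :
    ∃ M : ℝ, 0 < M ∧ ∀ x ∈ DB, ‖C x‖ ≤ M * (‖x‖ + ‖B x‖) := by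
  let G : Submodule ℂ (H × H) := DB.comap (LinearMap.fst ℂ H H) ⊓ B.graph
  have hG : IsClosed (G : Set (H × H)) := by
    have : (G : Set (H × H)) = {p : H × H | p.1 ∈ DB ∧ B p.1 = p.2} := by
      ext p
      simp [G, LinearMap.mem_graph_iff, eq_comm]
    rw [this]; exact hBclosed
  have : CompleteSpace G := hG.completeSpace_coe
  let g : G →ₗ[ℂ] H := C.comp ((LinearMap.fst ℂ H H).comp G.subtype)
  have hg : Continuous g := by
    apply LinearMap.continuous_of_isClosed_graph
    have hc : Continuous (fun q : G × H => ((q.1 : H × H).1, q.2)) := by fun_prop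
    have h2 := IsClosed.preimage hc hCclosed
    convert h2 using 1
    ext ⟨⟨p, hp⟩, z⟩
    have : p.1 ∈ DC := hdom hp.1
    simp [LinearMap.mem_graph_iff, g, this, eq_comm]
  let gc : G →L[ℂ] H := ⟨g, hg⟩
  refine ⟨‖gc‖ + 1, by positivity, fun x hx => ?_⟩
  have h1 := gc.le_opNorm ⟨(x, B x), hx, by simp [LinearMap.mem_graph_iff]⟩
  have h2 : ‖(x, B x)‖ ≤ ‖x‖ + ‖B x‖ := by
    rw [Prod.norm_mk]
    exact max_le (by linarith [norm_nonneg (B x)]) (by linarith [norm_nonneg x])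
  have h3 : ‖C x‖ ≤ ‖gc‖ * ‖(x, B x)‖ := h1
  calc ‖C x‖ ≤ ‖gc‖ * ‖(x, B x)‖ := h3
    _ ≤ (‖gc‖ + 1) * (‖x‖ + ‖B x‖) := by
      gcongr
      linarith

/-- if `B` and `C` are closed, `B` is accretive, `B²` (with domain
`D(B²)`) is m-accretive, `C` is accretive and `D(B) ⊆ D(C)` (condition (C.4)),
then `Λ = B² + C` with domain `D(B²)` is m-accretive. -/
theorem stmt2 {H : Type*} [NormedAddCommGroup H] [InnerProductSpace ℂ H] [CompleteSpace H]
    (B C : H →ₗ[ℂ] H) (DB DC : Submodule ℂ H)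
    (hBclosed : IsClosedOn B DB) (hCclosed : IsClosedOn C DC)
    (hB : IsAccretiveOn B DB)
    (hB2 : IsMAccretiveOn (B.comp B) (DB ⊓ DB.comap B))
    (hC : IsAccretiveOn C DC)
    (hdom : DB ≤ DC) :
    IsMAccretiveOn (B.comp B + C) (DB ⊓ DB.comap B) := by
  obtain ⟨hA, hdense, l0, hl0, hs0⟩ := hB2
  refine ⟨?_, hdense, ?_⟩
  · intro x hx
    have h1 := hA x hx
    have h2 := hC x (hdom hx.1)
    rw [LinearMap.add_apply, inner_add_left, Complex.add_re]
    exact add_nonneg h1 h2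
  obtain ⟨M, hM, hCB⟩ := rel_bound B C DB DC hBclosed hCclosed hdom
  set D := DB ⊓ DB.comap B with hD
  set A := B.comp B with hAdef
  -- surjectivity for a sequence of parameters tending to infinity
  have hs : ∀ n : ℕ, ∀ y : H, ∃ x ∈ D, A x + ((l0 * (3 / 2) ^ n : ℝ) : ℂ) • x = y := by
    intro n
    induction n with
    | zero => simpa using hs0
    | succ n ih =>
      have hl : 0 < l0 * (3 / 2) ^ n := by positivity
      have hl1 : l0 * (3 / 2) ^ (n + 1) = l0 * (3 / 2) ^ n + l0 * (3 / 2) ^ n / 2 := by ring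
      rw [hl1]
      generalize l0 * (3 / 2) ^ n = l at ih hl
      intro y
      obtain ⟨x, hx, hxy⟩ := surj_perturb (A + (l : ℂ) • LinearMap.id)
        (((l / 2 : ℝ) : ℂ) • LinearMap.id) D (fun y => by simpa using ih y) (by
          intro x hx
          have := (accretive_est (A x) x (hA x hx) l hl).2
          have e : ‖(((l / 2 : ℝ) : ℂ)) • x‖ = l / 2 * ‖x‖ := by
            rw [norm_smul, Complex.norm_real, Real.norm_of_nonneg (by positivity)]
          simp only [LinearMap.add_apply, LinearMap.smul_apply, LinearMap.id_apply]
          rw [e]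
          linarith) y
      refine ⟨x, hx, ?_⟩
      rw [← hxy]
      simp only [LinearMap.add_apply, LinearMap.smul_apply, LinearMap.id_apply,
        Complex.ofReal_add, add_smul, add_assoc]
  obtain ⟨n, hn⟩ := pow_unbounded_of_one_lt (4 * M * (1 + 4 * M) / l0)
    (by norm_num : (1 : ℝ) < 3 / 2)
  have hlam : 4 * M * (1 + 4 * M) < l0 * (3 / 2) ^ n := by
    rw [div_lt_iff₀ hl0] at hn
    linarith
  have hs := hs n
  generalize l0 * (3 / 2) ^ n = l at hs hlam
  have hl : 0 < l := lt_trans (by positivity) hlam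
  refine ⟨l, hl, fun y => ?_⟩
  obtain ⟨x, hx, hxy⟩ := surj_perturb (A + (l : ℂ) • LinearMap.id) C D
    (fun y => by simpa using hs y) (by
      intro x hx
      obtain ⟨e1, e2⟩ := accretive_est (A x) x (hA x hx) l hl
      have e3 := hCB x hx.1
      have e4 : 4 * M * ‖B x‖ ≤ ‖A x‖ + (4 * M) ^ 2 * ‖x‖ := by
        refine landau_est (A x) (B x) x (4 * M) (by positivity) (hA x hx) ?_
        have hm : B x - ((4 * M : ℝ) : ℂ) • x ∈ DB :=
          DB.sub_mem hx.2 (DB.smul_mem _ hx.1)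
        have := hB _ hm
        rwa [map_sub, map_smul] at this
      simp only [LinearMap.add_apply, LinearMap.smul_apply, LinearMap.id_apply]
      have e5 : 4 * M * (1 + 4 * M) * ‖x‖ ≤ l * ‖x‖ := by gcongr
      nlinarith) y
  refine ⟨x, hx, ?_⟩
  rw [← hxy]
  simp only [LinearMap.add_apply, LinearMap.smul_apply, LinearMap.id_apply]
  abel
end

section
/- Let H be a complex Hilbert space, and let B and C be linear operators in H such that B² (with domain D(B²)) is closed, C is closed, and D(B²) ⊆ D(C). Assume there exist constants α ≥ 0, 0 ≤ β < 1 and δ ≥ 0 such that Re⟨B²x, Cx⟩ ≥ −α‖x‖² − β‖B²x‖² − δ‖B²x‖·‖x‖ for all x ∈ D(B²). If D(B²) is dense in H, then the operator B² + C with domain D(B²) is closed. -/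
/-- if `B²` (with domain `D(B²)`) and `C` are closed, `D(B²) ⊆ D(C)`,
condition (C.1) holds and `D(B²)` is dense, then `B² + C` with domain `D(B²)` is
closed. -/
theorem stmt4 {H : Type*} [NormedAddCommGroup H] [InnerProductSpace ℂ H] [CompleteSpace H]
    (B C : H →ₗ[ℂ] H) (DB DC : Submodule ℂ H)
    (hB2closed : IsClosedOn (B.comp B) (DB ⊓ DB.comap B))
    (hCclosed : IsClosedOn C DC)
    (hdom : DB ⊓ DB.comap B ≤ DC)
    (α β δ : ℝ) (hα : 0 ≤ α) (hβ0 : 0 ≤ β) (hβ1 : β < 1) (hδ : 0 ≤ δ)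
    (hC1 : ∀ x ∈ DB ⊓ DB.comap B,
      -α * ‖x‖ ^ 2 - β * ‖B (B x)‖ ^ 2 - δ * ‖B (B x)‖ * ‖x‖ ≤
        (inner ℂ (B (B x)) (C x) : ℂ).re)
    (hdense : Dense ((DB ⊓ DB.comap B : Submodule ℂ H) : Set H)) :
    IsClosedOn (B.comp B + C) (DB ⊓ DB.comap B) := by
  have key : ∀ x ∈ DB ⊓ DB.comap B,
      ‖B (B x)‖ ≤ (‖B (B x) + C x‖ + (δ + α + 1) * ‖x‖) / (1 - β) := by
    intro x hx
    have h1 := hC1 x hx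
    have h2 : (inner ℂ (B (B x)) (B (B x) + C x) : ℂ).re ≤ ‖B (B x)‖ * ‖B (B x) + C x‖ :=
      re_inner_le_norm (𝕜 := ℂ) _ _
    have h3 : (inner ℂ (B (B x)) (B (B x)) : ℂ).re = ‖B (B x)‖ ^ 2 :=
      inner_self_eq_norm_sq (𝕜 := ℂ) _
    rw [inner_add_right, Complex.add_re, h3] at h2
    have ha := norm_nonneg (B (B x))
    have hs := norm_nonneg (B (B x) + C x)
    have hr := norm_nonneg x
    generalize (inner ℂ (B (B x)) (C x) : ℂ).re = t at *
    generalize ‖B (B x)‖ = a at *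
    generalize ‖B (B x) + C x‖ = s at *
    generalize ‖x‖ = r at *
    rw [le_div_iff₀ (by linarith)]
    have e1 := mul_nonneg hα hr
    have e2 := mul_nonneg hδ hr
    have e3 := mul_nonneg hβ0 ha
    rcases le_or_gt a r with h | h
    · nlinarith
    · have hapos : 0 < a := lt_of_le_of_lt hr h
      have e4 : α * r ^ 2 ≤ α * r * a := by nlinarith
      have e5 : a * (a * (1 - β)) ≤ a * (s + (δ + α) * r) := by nlinarith
      have := le_of_mul_le_mul_left e5 hapos
      nlinarith
  apply IsSeqClosed.isClosed
  intro p q hp hpq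
  have hx : Filter.Tendsto (fun n => (p n).1) Filter.atTop (nhds q.1) :=
    (continuous_fst.tendsto q).comp hpq
  have hy : Filter.Tendsto (fun n => (p n).2) Filter.atTop (nhds q.2) :=
    (continuous_snd.tendsto q).comp hpq
  have hpD : ∀ n, (p n).1 ∈ DB ⊓ DB.comap B := fun n => (hp n).1
  have hpe : ∀ n, B (B (p n).1) + C (p n).1 = (p n).2 := fun n => (hp n).2
  have hc : CauchySeq (fun n => B (B (p n).1)) := by
    rw [cauchySeq_iff_tendsto_dist_atTop_0]
    have c1 := cauchySeq_iff_tendsto_dist_atTop_0.1 hx.cauchySeq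
    have c2 := cauchySeq_iff_tendsto_dist_atTop_0.1 hy.cauchySeq
    have c3 := (c2.add (c1.const_mul (δ + α + 1))).div_const (1 - β)
    simp only [mul_zero, add_zero, zero_div] at c3
    refine squeeze_zero (fun _ => dist_nonneg) (fun n => ?_) c3
    have := key _ (Submodule.sub_mem _ (hpD n.1) (hpD n.2))
    simp only [dist_eq_norm]
    rw [← hpe n.1, ← hpe n.2]
    simp only [map_sub] at this
    rw [add_sub_add_comm]
    exact this
  obtain ⟨z, hz⟩ := cauchySeq_tendsto_of_complete hc
  have hB := hB2closed.isSeqClosed (x := fun n => ((p n).1, B (B (p n).1))) (p := (q.1, z))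
    (fun n => ⟨hpD n, rfl⟩) (hx.prodMk_nhds hz)
  have hCz : Filter.Tendsto (fun n => C (p n).1) Filter.atTop (nhds (q.2 - z)) := by
    refine (hy.sub hz).congr (fun n => ?_)
    rw [← hpe n]
    abel
  have hC := hCclosed.isSeqClosed (x := fun n => ((p n).1, C (p n).1)) (p := (q.1, q.2 - z))
    (fun n => ⟨hdom (hpD n), rfl⟩) (hx.prodMk_nhds hCz)
  refine ⟨hB.1, ?_⟩
  have b1 : B (B q.1) = z := hB.2
  have b2 : C q.1 = q.2 - z := hC.2
  change B (B q.1) + C q.1 = q.2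
  rw [b1, b2]
  abel
end

section
/- Let H be a complex Hilbert space, and let B and C be linear operators in H with D(B²) ⊆ D(C). Assume there exist constants α ≥ 0, 0 ≤ β < 1 and δ ≥ 0 such that Re⟨B²x, Cx⟩ ≥ −α‖x‖² − β‖B²x‖² − δ‖B²x‖·‖x‖ for all x ∈ D(B²). Then there exists a constant κ ≥ 0 such that ‖B²x‖ ≤ (1/(1−β))‖(B² + C)x‖ + κ‖x‖ for all x ∈ D(B²). -/
/-- under condition (C.1) there is a constant `κ ≥ 0` such that
`‖B²x‖ ≤ (1/(1-β))‖(B² + C)x‖ + κ‖x‖` for all `x ∈ D(B²)`. -/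
theorem stmt5 {H : Type*} [NormedAddCommGroup H] [InnerProductSpace ℂ H]
    (B C : H →ₗ[ℂ] H) (DB DC : Submodule ℂ H)
    (hdom : DB ⊓ DB.comap B ≤ DC)
    (α β δ : ℝ) (hα : 0 ≤ α) (hβ0 : 0 ≤ β) (hβ1 : β < 1) (hδ : 0 ≤ δ)
    (hC1 : ∀ x ∈ DB ⊓ DB.comap B,
      -α * ‖x‖ ^ 2 - β * ‖B (B x)‖ ^ 2 - δ * ‖B (B x)‖ * ‖x‖ ≤
        (inner ℂ (B (B x)) (C x) : ℂ).re) :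
    ∃ κ : ℝ, 0 ≤ κ ∧ ∀ x ∈ DB ⊓ DB.comap B,
      ‖B (B x)‖ ≤ (1 / (1 - β)) * ‖B (B x) + C x‖ + κ * ‖x‖ := by
  have ht : 0 < 1 - β := by linarith
  refine ⟨(α + δ) / (1 - β) + 1, by positivity, fun x hx => ?_⟩
  have h1 := hC1 x hx
  have h2 : ‖B (B x)‖ ^ 2 + (inner ℂ (B (B x)) (C x) : ℂ).re ≤
      ‖B (B x)‖ * ‖B (B x) + C x‖ := by
    have h3 := re_inner_le_norm (𝕜 := ℂ) (B (B x)) (B (B x) + C x)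
    rw [inner_add_right, map_add, inner_self_eq_norm_sq] at h3
    exact h3
  have hb := norm_nonneg (B (B x))
  have hs := norm_nonneg (B (B x) + C x)
  have hn := norm_nonneg x
  generalize ‖B (B x)‖ = b at *
  generalize ‖B (B x) + C x‖ = s at *
  generalize ‖x‖ = n at *
  have key : (1 - β) * b ^ 2 ≤ b * s + α * n ^ 2 + δ * b * n := by linarith
  by_contra hcon
  push Not at hcon
  have e : 1 / (1 - β) * s + ((α + δ) / (1 - β) + 1) * n =
      (s + (α + δ + (1 - β)) * n) / (1 - β) := by
    field_simp
  rw [e, div_lt_iff₀ ht] at hcon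
  have hbn : n < b := by
    have : (1 - β) * n < (1 - β) * b := by
      nlinarith [mul_nonneg hα hn, mul_nonneg hδ hn]
    exact lt_of_mul_lt_mul_left this ht.le
  have hb0 : 0 < b := lt_of_le_of_lt hn hbn
  have h5 := mul_lt_mul_of_pos_left hcon hb0
  have h6 : α * n * n ≤ α * n * b := mul_le_mul_of_nonneg_left hbn.le (mul_nonneg hα hn)
  have h7 : 0 ≤ (1 - β) * (n * b) := by positivity
  nlinarith
end

section
/- Let H be a complex Hilbert space and let B be a closed accretive linear operator in H such that B² (with domain D(B²) = {x ∈ D(B) : Bx ∈ D(B)}) is m-accretive. Then B itself is m-accretive. -/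
theorem stmt7_step {H : Type*} [NormedAddCommGroup H] [InnerProductSpace ℂ H] [CompleteSpace H]
    (B : H →ₗ[ℂ] H) (D : Submodule ℂ H) (z w : ℂ) (C : ℝ)
    (hs : ∀ y : H, ∃ x ∈ D, B x + z • x = y)
    (hb : ∀ x ∈ D, ‖x‖ ≤ C * ‖B x + z • x‖)
    (hC : ‖w - z‖ * C < 1) :
    ∀ y : H, ∃ x ∈ D, B x + w • x = y := by
  intro y
  choose R hRD hR using hs
  have hlip : ∀ u v, ‖R u - R v‖ ≤ C * ‖u - v‖ := by
    intro u v
    have h := hb _ (D.sub_mem (hRD u) (hRD v))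
    have e : B (R u - R v) + z • (R u - R v) = u - v := by
      rw [map_sub, smul_sub]
      nth_rewrite 3 [← hR u]
      nth_rewrite 3 [← hR v]
      abel
    rwa [e] at h
  have hc : ContractingWith (Real.toNNReal (‖w - z‖ * C)) (fun u => y - (w - z) • R u) := by
    refine ⟨by simpa using hC, LipschitzWith.of_dist_le_mul fun u v => ?_⟩
    rw [dist_eq_norm, dist_eq_norm]
    have e : y - (w - z) • R u - (y - (w - z) • R v) = -((w - z) • (R u - R v)) := by
      rw [smul_sub]; abel
    rw [e, norm_neg, norm_smul]
    calc ‖w - z‖ * ‖R u - R v‖ ≤ ‖w - z‖ * (C * ‖u - v‖) := by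
          gcongr; exact hlip u v
      _ = (‖w - z‖ * C) * ‖u - v‖ := by ring
      _ ≤ _ := by gcongr; exact Real.le_coe_toNNReal _
  have hf := hc.fixedPoint_isFixedPt
  set u := ContractingWith.fixedPoint (fun u => y - (w - z) • R u) hc
  have hf' : y - (w - z) • R u = u := hf
  refine ⟨R u, hRD u, ?_⟩
  have h1 := hR u
  have : B (R u) + w • R u = (B (R u) + z • R u) + (w - z) • R u := by
    rw [sub_smul]; abel
  rw [this, h1]
  nth_rewrite 1 [← hf']
  abel

theorem stmt7_bound {H : Type*} [NormedAddCommGroup H] [InnerProductSpace ℂ H]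
    (B : H →ₗ[ℂ] H) (D : Submodule ℂ H) (hB : IsAccretiveOn B D) (z : ℂ) (hz : 0 < z.re) :
    ∀ x ∈ D, ‖x‖ ≤ z.re⁻¹ * ‖B x + z • x‖ := by
  intro x hx
  have h1 : (inner ℂ (B x + z • x) x : ℂ).re = (inner ℂ (B x) x : ℂ).re + z.re * ‖x‖ ^ 2 := by
    rw [inner_add_left, inner_smul_left, inner_self_eq_norm_sq_to_K, Complex.add_re]
    congr 1
    rw [← RCLike.ofReal_pow]
    simp [-Complex.ofReal_pow]
  have h2 : (inner ℂ (B x + z • x) x : ℂ).re ≤ ‖B x + z • x‖ * ‖x‖ :=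
    re_inner_le_norm (𝕜 := ℂ) _ _
  have h3 := hB x hx
  rcases (norm_nonneg x).eq_or_lt with h0 | h0
  · rw [← h0]; positivity
  · have : z.re * ‖x‖ ≤ ‖B x + z • x‖ := by
      by_contra hcon
      push Not at hcon
      nlinarith
    rw [inv_mul_eq_div, le_div_iff₀ hz]; linarith

theorem stmt7_closed {H : Type*} [NormedAddCommGroup H] [InnerProductSpace ℂ H] [CompleteSpace H]
    (B : H →ₗ[ℂ] H) (D : Submodule ℂ H) (hc : IsClosedOn B D) (z : ℂ)
    (hs : ∀ y : H, ∃ x ∈ D, B x + z • x = y)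
    (hi : ∀ x ∈ D, B x + z • x = 0 → x = 0) :
    ∃ C > 0, ∀ x ∈ D, ‖x‖ ≤ C * ‖B x + z • x‖ := by
  let G : Submodule ℂ (H × H) :=
    { carrier := {p : H × H | p.1 ∈ D ∧ B p.1 = p.2}
      add_mem' := by
        rintro a b ⟨h1, h2⟩ ⟨h3, h4⟩
        exact ⟨D.add_mem h1 h3, by simp [h2, h4]⟩
      zero_mem' := ⟨D.zero_mem, by simp⟩
      smul_mem' := by
        rintro c a ⟨h1, h2⟩
        exact ⟨D.smul_mem c h1, by simp [h2]⟩ }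
  have hG : IsClosed (G : Set (H × H)) := hc
  haveI : CompleteSpace G := hG.completeSpace_coe
  let f : G →L[ℂ] H :=
    (ContinuousLinearMap.snd ℂ H H + z • ContinuousLinearMap.fst ℂ H H).comp G.subtypeL
  have hf : ∀ p : G, f p = p.1.2 + z • p.1.1 := fun p => rfl
  have hsurj : Function.Surjective f := by
    intro y
    obtain ⟨x, hx, h⟩ := hs y
    exact ⟨⟨(x, B x), hx, rfl⟩, h⟩
  obtain ⟨C, hC, h⟩ := f.exists_preimage_norm_le hsurj
  refine ⟨C, hC, fun x hx => ?_⟩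
  obtain ⟨p, hp, hn⟩ := h (B x + z • x)
  have hp1 : p.1.1 ∈ D := p.2.1
  have hp2 : B p.1.1 = p.1.2 := p.2.2
  have : x = p.1.1 := by
    have := hi (x - p.1.1) (D.sub_mem hx hp1) (by
      rw [hf, ← hp2] at hp
      rw [map_sub, smul_sub, sub_add_sub_comm, hp, sub_self])
    exact sub_eq_zero.mp this
  calc ‖x‖ = ‖p.1.1‖ := by rw [this]
    _ ≤ ‖p.1‖ := norm_fst_le p.1
    _ ≤ _ := hn

/-- a closed accretive operator `B` such that `B²` (with domain
`D(B²) = {x ∈ D(B) : Bx ∈ D(B)}`) is m-accretive is itself m-accretive. -/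
theorem stmt7 {H : Type*} [NormedAddCommGroup H] [InnerProductSpace ℂ H] [CompleteSpace H]
    (B : H →ₗ[ℂ] H) (DB : Submodule ℂ H)
    (hBclosed : IsClosedOn B DB)
    (hB : IsAccretiveOn B DB)
    (hB2 : IsMAccretiveOn (B.comp B) (DB ⊓ DB.comap B)) :
    IsMAccretiveOn B DB := by
  obtain ⟨hacc, hd, lam, hl, hs⟩ := hB2
  refine ⟨hB, hd.mono (fun x hx => hx.1), ?_⟩
  set μ := √lam with hμ
  have hμ0 : 0 < μ := Real.sqrt_pos.mpr hl
  have hμ2 : (lam : ℂ) = μ * μ := by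
    rw [← Complex.ofReal_mul, Real.mul_self_sqrt hl.le]
  have hI : Complex.I * Complex.I = -1 := Complex.I_mul_I
  have hs1 : ∀ y : H, ∃ x ∈ DB, B x + (Complex.I * μ) • x = y := by
    intro y
    obtain ⟨x, ⟨hx1, hx2⟩, h⟩ := hs y
    refine ⟨B x - (Complex.I * μ) • x, DB.sub_mem hx2 (DB.smul_mem _ hx1), ?_⟩
    rw [← h, map_sub, map_smul, smul_sub, smul_smul, LinearMap.comp_apply, hμ2,
      show Complex.I * (μ : ℂ) * (Complex.I * μ) = -(μ * μ) by linear_combination (μ * μ : ℂ) * hI,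
      neg_smul]
    abel
  have hi1 : ∀ x ∈ DB, B x + (Complex.I * μ) • x = 0 → x = 0 := by
    intro x hx h
    have hBx : B x = -((Complex.I * μ) • x) := eq_neg_of_add_eq_zero_left h
    have hm : B x ∈ DB := by rw [hBx]; exact DB.neg_mem (DB.smul_mem _ hx)
    have hBB : (B.comp B) x + (lam : ℂ) • x = 0 := by
      rw [LinearMap.comp_apply, hBx, map_neg, map_smul, hBx, smul_neg, neg_neg, smul_smul,
        ← add_smul, hμ2,
        show Complex.I * (μ : ℂ) * (Complex.I * μ) + μ * μ = 0 by
          linear_combination (μ * μ : ℂ) * hI, zero_smul]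
    have := stmt7_bound (B.comp B) _ hacc (lam : ℂ) (by simpa using hl) x ⟨hx, hm⟩
    rw [hBB, norm_zero, mul_zero] at this
    exact norm_le_zero_iff.mp this
  obtain ⟨C, hC, hb⟩ := stmt7_closed B DB hBclosed _ hs1 hi1
  obtain ⟨ε, hε, hεC⟩ : ∃ ε : ℝ, 0 < ε ∧ ε * C < 1 :=
    ⟨(2 * C)⁻¹, by positivity, by rw [mul_inv, mul_assoc, inv_mul_cancel₀ hC.ne']; norm_num⟩
  obtain ⟨N, hN⟩ := exists_nat_gt (μ / ε)
  have hN0 : (0 : ℝ) < N := lt_trans (by positivity) hN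
  have key : ∀ k : ℕ, ∀ y : H, ∃ x ∈ DB,
      B x + ((ε : ℂ) + Complex.I * ((μ - k * (μ / N) : ℝ) : ℂ)) • x = y := by
    intro k
    induction k with
    | zero =>
      refine stmt7_step B DB _ _ C hs1 hb ?_
      have : ((ε : ℂ) + Complex.I * ((μ - (0 : ℕ) * (μ / N) : ℝ) : ℂ)) - Complex.I * μ = ε := by
        push_cast; ring
      rw [this, Complex.norm_real, Real.norm_of_nonneg hε.le]
      exact hεC
    | succ k ih =>
      have hre : ((ε : ℂ) + Complex.I * ((μ - k * (μ / N) : ℝ) : ℂ)).re = ε := by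
        rw [Complex.add_re, Complex.ofReal_re, Complex.I_mul_re, Complex.ofReal_im]; ring
      refine stmt7_step B DB _ _ _ ih (stmt7_bound B DB hB _ (by rw [hre]; exact hε)) ?_
      rw [hre]
      have : ((ε : ℂ) + Complex.I * ((μ - (k + 1 : ℕ) * (μ / N) : ℝ) : ℂ)) -
          ((ε : ℂ) + Complex.I * ((μ - k * (μ / N) : ℝ) : ℂ)) =
          -(Complex.I * ((μ / N : ℝ) : ℂ)) := by
        push_cast; ring
      rw [this, norm_neg, norm_mul, Complex.norm_I, one_mul, Complex.norm_real,
        Real.norm_of_nonneg (by positivity), ← div_eq_mul_inv, div_lt_one hε,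
        div_lt_iff₀ hN0]
      rw [div_lt_iff₀ hε] at hN
      linarith
  refine ⟨ε, hε, ?_⟩
  have h := key N
  have e : (μ - N * (μ / N) : ℝ) = 0 := by field_simp; ring
  rw [e] at h
  simpa using h
end

section
/- Let H be a complex Hilbert space, let B be an m-θ-accretive linear operator in H with 0 ≤ θ < π/2, and let S be an m-(π/4)-accretive linear operator in H with D(S) ⊆ D(B). Then the null space of Z₁ = B + S (with domain D(S)) equals N(B) ∩ N(S), i.e. for x ∈ D(S): Bx + Sx = 0 if and only if Bx = 0 and Sx = 0. -/
/-- `T` is `ω`-accretive (sectorial with vertex `0` and semi-angle `ω`) on `D`: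
`|Im ⟨Tx, x⟩| ≤ tan ω · Re ⟨Tx, x⟩` for all `x ∈ D`. -/
def IsSectorialOn {H : Type*} [NormedAddCommGroup H] [InnerProductSpace ℂ H]
    (T : H →ₗ[ℂ] H) (D : Submodule ℂ H) (ω : ℝ) : Prop :=
  ∀ x ∈ D, |(inner ℂ (T x) x : ℂ).im| ≤ Real.tan ω * (inner ℂ (T x) x : ℂ).re

/-- `T` with domain `D` is m-`ω`-accretive: both `ω`-accretive and m-accretive. -/
def IsMSectorialOn {H : Type*} [NormedAddCommGroup H] [InnerProductSpace ℂ H]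
    (T : H →ₗ[ℂ] H) (D : Submodule ℂ H) (ω : ℝ) : Prop :=
  IsSectorialOn T D ω ∧ IsMAccretiveOn T D

theorem quad_aux (p r : ℝ) (h : ∀ t : ℝ, 0 ≤ t * p + t ^ 2 * r) : p = 0 := by
  have hr : 0 < |r| + 1 := by positivity
  have h1 := h (-p / (|r| + 1))
  have h2 : -p / (|r| + 1) * p + (-p / (|r| + 1)) ^ 2 * r
      = p ^ 2 * (r - |r| - 1) / (|r| + 1) ^ 2 := by
    field_simp
    ring
  rw [h2] at h1
  by_contra hp
  have hp2 : 0 < p ^ 2 := by positivity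
  have : p ^ 2 * (r - |r| - 1) / (|r| + 1) ^ 2 < 0 := by
    apply div_neg_of_neg_of_pos _ (by positivity)
    have := le_abs_self r
    nlinarith
  linarith

theorem sect_null {H : Type*} [NormedAddCommGroup H] [InnerProductSpace ℂ H]
    (T : H →ₗ[ℂ] H) (D : Submodule ℂ H) (ω : ℝ) (hT : IsMSectorialOn T D ω)
    (x : H) (hx : x ∈ D) (h0 : (inner ℂ (T x) x : ℂ).re = 0) : T x = 0 := by
  obtain ⟨hs, ha, hd, -⟩ := hT
  have him : (inner ℂ (T x) x : ℂ).im = 0 := by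
    have := hs x hx
    rw [h0, mul_zero] at this
    exact abs_nonpos_iff.mp this
  have hin : (inner ℂ (T x) x : ℂ) = 0 := Complex.ext h0 him
  have key : ∀ y ∈ D, (inner ℂ (T x) y : ℂ) + inner ℂ (T y) x = 0 := by
    intro y hy
    have hexp : ∀ t : ℝ, (inner ℂ (T (x + (t : ℂ) • y)) (x + (t : ℂ) • y) : ℂ)
        = (t : ℂ) * (inner ℂ (T x) y + inner ℂ (T y) x) + ((t ^ 2 : ℝ) : ℂ) * inner ℂ (T y) y := by
      intro t
      simp only [map_add, map_smul, inner_add_left, inner_add_right, inner_smul_left,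
        inner_smul_right, hin, Complex.conj_ofReal]
      push_cast
      ring
    have hm : ∀ t : ℝ, x + (t : ℂ) • y ∈ D := fun t => D.add_mem hx (D.smul_mem _ hy)
    have hre : ((inner ℂ (T x) y : ℂ) + inner ℂ (T y) x).re = 0 := by
      apply quad_aux _ (inner ℂ (T y) y : ℂ).re
      intro t
      have := ha _ (hm t)
      rwa [hexp, Complex.add_re, Complex.re_ofReal_mul, Complex.re_ofReal_mul] at this
    refine Complex.ext hre ?_
    apply quad_aux _ ((inner ℂ (T y) y : ℂ).im + Real.tan ω * (inner ℂ (T y) y : ℂ).re)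
    intro t
    have := (abs_le.mp (hs _ (hm t))).1
    rw [hexp, Complex.add_re, Complex.re_ofReal_mul, Complex.re_ofReal_mul, hre,
      Complex.add_im, Complex.im_ofReal_mul, Complex.im_ofReal_mul] at this
    linarith
  have hz : ∀ y ∈ D, (inner ℂ (T x) y : ℂ) = 0 := by
    intro y hy
    have h1 := key y hy
    have h2 := key (Complex.I • y) (D.smul_mem _ hy)
    simp only [map_smul, inner_smul_left, inner_smul_right, Complex.conj_I] at h2
    have h3 : (inner ℂ (T x) y : ℂ) - inner ℂ (T y) x = 0 := by
      apply mul_left_cancel₀ Complex.I_ne_zero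
      linear_combination h2
    linear_combination (h1 + h3) / 2
  exact hd.eq_zero_of_inner_left ℂ (fun v hv => hz v hv)

/-- if `B` is m-`θ`-accretive with `0 ≤ θ < π/2` and `S` is
m-`(π/4)`-accretive with `D(S) ⊆ D(B)`, then the null space of `Z₁ = B + S`
(with domain `D(S)`) is `N(B) ∩ N(S)`. -/
theorem stmt13 {H : Type*} [NormedAddCommGroup H] [InnerProductSpace ℂ H] [CompleteSpace H]
    (B S : H →ₗ[ℂ] H) (DB DS : Submodule ℂ H)
    (θ : ℝ) (hθ0 : 0 ≤ θ) (hθ1 : θ < Real.pi / 2)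
    (hB : IsMSectorialOn B DB θ)
    (hS : IsMSectorialOn S DS (Real.pi / 4))
    (hdom : DS ≤ DB) :
    ∀ x ∈ DS, (B x + S x = 0 ↔ B x = 0 ∧ S x = 0) := by
  intro x hx
  constructor
  · intro h
    have hs : (inner ℂ (B x) x : ℂ).re + (inner ℂ (S x) x : ℂ).re = 0 := by
      rw [← Complex.add_re, ← inner_add_left, h, inner_zero_left, Complex.zero_re]
    have h1 := hB.2.1 x (hdom hx)
    have h2 := hS.2.1 x hx
    exact ⟨sect_null B DB θ hB x (hdom hx) (by linarith),
      sect_null S DS _ hS x hx (by linarith)⟩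
  · rintro ⟨h1, h2⟩
    rw [h1, h2, add_zero]
end

section
/- Let B be the 2×2 complex matrix B = [[4−i, 4i], [4i, 16+4i]], acting on ℂ² with the standard inner product, and let e₁ = (1, 0). Then ⟨B²e₁, e₁⟩ = −1 − 8i; in particular Re⟨B²e₁, e₁⟩ < 0, so B² is not accretive even though the numerical range of B is contained in the open sector {z : |Im z| < Re z} ∪ {0}. -/
open Complex

/-- for the matrix `B = [[4−i, 4i], [4i, 16+4i]]` on `ℂ²` and
`e₁ = (1,0)`, one has `⟨B²e₁, e₁⟩ = −1 − 8i`, in particular `Re ⟨B²e₁, e₁⟩ < 0`,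
so `B²` is not accretive, even though the numerical range of `B` is contained in
the open sector `{z : |Im z| < Re z} ∪ {0}`.  (The paper's inner product
`⟨u, v⟩ = ∑ uᵢ conj(vᵢ)` is linear in the first argument, i.e. it is `inner v u`
in Mathlib's convention.) -/
theorem stmt15
    (B : EuclideanSpace ℂ (Fin 2) →ₗ[ℂ] EuclideanSpace ℂ (Fin 2))
    (hB : B = Matrix.toEuclideanLin !![4 - I, 4 * I; 4 * I, 16 + 4 * I])
    (e₁ : EuclideanSpace ℂ (Fin 2)) (he₁ : e₁ = EuclideanSpace.single 0 1) :
    (inner ℂ e₁ (B (B e₁)) : ℂ) = -1 - 8 * I ∧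
      (inner ℂ e₁ (B (B e₁)) : ℂ).re < 0 ∧
      ¬ (∀ x : EuclideanSpace ℂ (Fin 2), 0 ≤ (inner ℂ x (B (B x)) : ℂ).re) ∧
      (∀ x : EuclideanSpace ℂ (Fin 2),
        (inner ℂ x (B x) : ℂ) = 0 ∨ |(inner ℂ x (B x) : ℂ).im| < (inner ℂ x (B x) : ℂ).re) := by
  have h1 : (inner ℂ e₁ (B (B e₁)) : ℂ) = -1 - 8 * I := by
    subst hB he₁
    simp [PiLp.inner_apply, Fin.sum_univ_two, Matrix.toLpLin_apply, Matrix.mulVec,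
      dotProduct]
    ring_nf
    simp only [I_sq]
    ring
  have h2 : (inner ℂ e₁ (B (B e₁)) : ℂ).re < 0 := by
    rw [h1]; simp
  refine ⟨h1, h2, fun h => absurd (h e₁) (not_le.mpr h2), fun x => ?_⟩
  have hre : (inner ℂ x (B x) : ℂ).re = 4 * ((x 0).re ^ 2 + (x 0).im ^ 2)
      + 16 * ((x 1).re ^ 2 + (x 1).im ^ 2) := by
    subst hB
    simp [PiLp.inner_apply, Fin.sum_univ_two, Matrix.toLpLin_apply, Matrix.mulVec,
      dotProduct]
    ring
  have him : (inner ℂ x (B x) : ℂ).im = -((x 0).re ^ 2 + (x 0).im ^ 2)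
      + 4 * ((x 1).re ^ 2 + (x 1).im ^ 2)
      + 8 * ((x 0).re * (x 1).re + (x 0).im * (x 1).im) := by
    subst hB
    simp [PiLp.inner_apply, Fin.sum_univ_two, Matrix.toLpLin_apply, Matrix.mulVec,
      dotProduct]
    ring
  by_cases hx : x = 0
  · left; simp [hx]
  right
  have hpos : 0 < ((x 0).re ^ 2 + (x 0).im ^ 2) + ((x 1).re ^ 2 + (x 1).im ^ 2) := by
    by_contra hn
    apply hx
    have ha := sq_nonneg (x 0).re
    have hb := sq_nonneg (x 0).im
    have hc := sq_nonneg (x 1).re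
    have hd := sq_nonneg (x 1).im
    ext i
    fin_cases i <;> apply Complex.ext <;> simp <;> apply pow_eq_zero_iff (two_ne_zero) |>.mp <;>
      linarith
  rw [hre, him, abs_lt]
  generalize (x 0).re = a at *
  generalize (x 0).im = b at *
  generalize (x 1).re = c at *
  generalize (x 1).im = d at *
  constructor
  · nlinarith [sq_nonneg (a + 2 * c), sq_nonneg (b + 2 * d), sq_nonneg a, sq_nonneg b,
      sq_nonneg c, sq_nonneg d]
  · nlinarith [sq_nonneg (a - c), sq_nonneg (b - d), sq_nonneg a, sq_nonneg b,
      sq_nonneg c, sq_nonneg d]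
end

section
/- Let H be a complex Hilbert space, let B and C be bounded linear operators on H, let λ = α + iβ with α, β real, and suppose v ∈ H with ‖v‖ = 1 satisfies λ²v − 2λBv − Cv = 0. If Re⟨Cv, v⟩ ≥ 0 and |Im⟨Bv, v⟩| ≤ Re⟨Bv, v⟩, then 2(α − |β|)·Re⟨Bv, v⟩ ≤ α² − β². -/
open Complex

/-- if `v` is a unit eigenvector of the pencil
`Q(λ) = λ²I − 2λB − C` at `λ = α + iβ`, with `Re ⟨Cv, v⟩ ≥ 0` and
`|Im ⟨Bv, v⟩| ≤ Re ⟨Bv, v⟩`, then `2(α − |β|) Re ⟨Bv, v⟩ ≤ α² − β²`.  (The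
paper's inner product is linear in the first argument, i.e. `⟨Tv, v⟩` is
`inner v (T v)` in Mathlib's convention.) -/
theorem stmt17 {H : Type*} [NormedAddCommGroup H] [InnerProductSpace ℂ H]
    (B C : H →L[ℂ] H) (α β : ℝ) (lam : ℂ) (hlam : lam = α + β * I)
    (v : H) (hv : ‖v‖ = 1)
    (heig : lam ^ 2 • v - (2 * lam) • B v - C v = 0)
    (hC : 0 ≤ (inner ℂ v (C v) : ℂ).re)
    (hB : |(inner ℂ v (B v) : ℂ).im| ≤ (inner ℂ v (B v) : ℂ).re) :
    2 * (α - |β|) * (inner ℂ v (B v) : ℂ).re ≤ α ^ 2 - β ^ 2 := by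
  have h := congrArg (fun w => (inner ℂ v w : ℂ)) heig
  simp only [inner_sub_right, inner_smul_right, inner_zero_right,
    inner_self_eq_norm_sq_to_K, hv] at h
  generalize (inner ℂ v (B v) : ℂ) = b at *
  generalize (inner ℂ v (C v) : ℂ) = c at *
  have hr := congrArg Complex.re h
  subst hlam
  simp [pow_two] at hr
  have h1 : β * b.im ≤ |β| * b.re :=
    calc β * b.im ≤ |β * b.im| := le_abs_self _
      _ = |β| * |b.im| := abs_mul _ _
      _ ≤ |β| * b.re := mul_le_mul_of_nonneg_left hB (abs_nonneg _)
  nlinarith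
end
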